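/- arXiv:math/0609114 — 4 statements merged into one kernel-verified Lean document; each statement's English description precedes it below -/
import Mathlib

section
/- Let 𝓜 be a loc-lattice of subsets of a set X which completely separates the points of a subset Y of X. Then there exists an 𝓜-consistent linear ordering ≤ of Y; moreover, every other 𝓜-consistent linear ordering of Y is equal to ≤ or to the inverse order of ≤. -/
universe u

/-- `(xyz)_𝓜` : every member of `𝓜` containing `x` and `z` also contains `y`. -/
def MBtw {X : Type u} (𝓜 : Set (Set X)) (x y z : X) : Prop :=
  ∀ M ∈ 𝓜, x ∈ M → z ∈ M → y ∈ M

/-- Convexity of a set with respect to a relation `le`. -/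
def RelConvex {X : Type u} (le : X → X → Prop) (S : Set X) : Prop :=
  ∀ a b c : X, a ∈ S → c ∈ S → le a b → le b c → b ∈ S

/-- A loc-lattice of subsets of `X`: `𝓜` is a lattice under inclusion whose joins are
given by `sup` and whose meets are intersections, satisfying conditions (1)-(4) of
Definition 2.1 of the paper. -/
structure SetLocLattice {X : Type u} (𝓜 : Set (Set X)) (sup : Set X → Set X → Set X) :
    Prop where
  sup_mem : ∀ A ∈ 𝓜, ∀ B ∈ 𝓜, sup A B ∈ 𝓜
  subset_sup_left : ∀ A ∈ 𝓜, ∀ B ∈ 𝓜, A ⊆ sup A B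
  subset_sup_right : ∀ A ∈ 𝓜, ∀ B ∈ 𝓜, B ⊆ sup A B
  sup_least : ∀ A ∈ 𝓜, ∀ B ∈ 𝓜, ∀ C ∈ 𝓜, A ⊆ C → B ⊆ C → sup A B ⊆ C
  inter_mem : ∀ A ∈ 𝓜, ∀ B ∈ 𝓜, A ∩ B ∈ 𝓜
  sup_eq_union : ∀ A ∈ 𝓜, ∀ B ∈ 𝓜, (A ∩ B).Nonempty → sup A B = A ∪ B
  trichotomy : ∀ A ∈ 𝓜, ∀ B ∈ 𝓜, ∀ C ∈ 𝓜,
    A ⊆ sup B C ∨ B ⊆ sup A C ∨ C ⊆ sup A B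
  incomp : ∀ A ∈ 𝓜, ∀ B ∈ 𝓜, ∀ C ∈ 𝓜,
    (¬ A ⊆ B ∧ ¬ B ⊆ A) → (¬ A ⊆ C ∧ ¬ C ⊆ A) → (¬ B ⊆ C ∧ ¬ C ⊆ B) →
    B ⊆ sup A C → B = sup A B ∩ sup C B

/-- `𝓜` separates the points of `X`. -/
def SeparatesPoints {X : Type u} (𝓜 : Set (Set X)) : Prop :=
  ∀ x y : X, x ≠ y → ∃ M ∈ 𝓜, (x ∈ M ∧ y ∉ M) ∨ (x ∉ M ∧ y ∈ M)

/-- `𝓜` well separates `X`. -/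
def WellSeparates {X : Type u} (𝓜 : Set (Set X)) : Prop :=
  SeparatesPoints 𝓜 ∧ ∀ M ∈ 𝓜, ∀ x : X, x ∉ M → ∃ N ∈ 𝓜, x ∈ N ∧ ¬ N ⊆ M

/-- Two points are completely separated by `𝓜`. -/
def CompSeparated {X : Type u} (𝓜 : Set (Set X)) (x y : X) : Prop :=
  ∃ A ∈ 𝓜, ∃ B ∈ 𝓜, x ∈ A ∧ y ∉ A ∧ y ∈ B ∧ x ∉ B

/-- `𝓜` completely separates `X`. -/
def CompletelySeparates {X : Type u} (𝓜 : Set (Set X)) : Prop :=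
  ∀ x y : X, x ≠ y → CompSeparated 𝓜 x y

/-- The betweenness relations that come from a linear order. -/
structure IsLinearBetweenness {α : Type*} (B : α → α → α → Prop) : Prop where
  left : ∀ x z, B x x z
  symm : ∀ x y z, B x y z → B z y x
  total : ∀ x y z, B x y z ∨ B y x z ∨ B x z y
  antisymm : ∀ x y z, B x y z → B x z y → y = z
  trans : ∀ a b c d, B a b c → B a c d → B a b d
  no_star : ∀ a b c d, B a c d → B a b c → B c b d → b = c
  no_cycle : ∀ a b c d, a ≠ b → a ≠ c → a ≠ d → b ≠ c → b ≠ d → c ≠ d →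
    B a b c → B b c d → B c d a → B d a b → False

namespace IsLinearBetweenness

variable {α : Type*} {B : α → α → α → Prop} {p q : α}

theorem right (hB : IsLinearBetweenness B) (x z : α) : B x z z :=
  hB.symm _ _ _ (hB.left z x)

theorem inner (hB : IsLinearBetweenness B) {a b c d : α} (h₁ : B a b c) (h₂ : B a c d) :
    B b c d := by
  rcases hB.total b c d with h | h | h
  · exact h
  · rw [hB.no_star a b c d h₂ h₁ h]
    exact hB.left c d
  · have h₃ := hB.trans c d b a (hB.symm _ _ _ h) (hB.symm _ _ _ h₁)
    rw [hB.antisymm a c d h₂ (hB.symm _ _ _ h₃)]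
    exact hB.right b d

theorem extend (hB : IsLinearBetweenness B) {a b c d : α} (hbc : b ≠ c) (h₁ : B a b c)
    (h₂ : B b c d) : B a b d := by
  obtain ⟨left, symm, total, antisymm, trans, no_star, no_cycle⟩ := hB
  by_cases hab : a = b
  · grind
  by_cases hac : a = c
  · grind
  by_cases had : a = d
  · grind
  by_cases hbd : b = d
  · grind
  by_cases hcd : c = d
  · grind
  rcases total a b d with h | h | h
  · exact h
  · rcases total a c d with h' | h' | h'
    · exact trans _ _ _ _ h₁ h'
    · have := trans c b a d (symm _ _ _ h₁) h'
      exact absurd (antisymm d b c (symm _ _ _ this) (symm _ _ _ h₂)) hbc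
    · exact (no_cycle a b c d hab hac had hbc hbd hcd h₁ h₂ (symm _ _ _ h') (symm _ _ _ h)).elim
  · have := trans b c d a h₂ (symm _ _ _ h)
    exact absurd (antisymm a b c h₁ (symm _ _ _ this)) hbc

/-- `x` lies strictly on the side of `p` opposite to `q`. -/
def Before (B : α → α → α → Prop) (p q x : α) : Prop := B x p q ∧ x ≠ p

/-- The linear order with betweenness `B` in which `p` precedes `q`. -/
def Le (B : α → α → α → Prop) (p q x y : α) : Prop :=
  (Before B p q x ∧ ¬ Before B p q y) ∨ (¬ Before B p q x ∧ ¬ Before B p q y ∧ B p x y) ∨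
    (Before B p q x ∧ Before B p q y ∧ B x y p)

theorem of_not_before (hB : IsLinearBetweenness B) {x : α} (hx : ¬ Before B p q x) :
    B p x q ∨ B p q x := by
  by_cases h : x = p
  · exact h ▸ Or.inl (hB.left x q)
  · rcases hB.total x p q with h' | h' | h'
    · exact (hx ⟨h', h⟩).elim
    · exact Or.inl h'
    · exact Or.inr (hB.symm _ _ _ h')

theorem btw_of_before_of_not_before (hB : IsLinearBetweenness B) (hpq : p ≠ q) {x y : α}
    (hx : Before B p q x) (hy : ¬ Before B p q y) : B x p y := by
  rcases hB.of_not_before hy with h | h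
  · exact hB.symm _ _ _ (hB.inner (hB.symm _ _ _ h) (hB.symm _ _ _ hx.1))
  · exact hB.extend hpq hx.1 h

theorem total_of_not_before (hB : IsLinearBetweenness B) {x y : α}
    (hx : ¬ Before B p q x) (hy : ¬ Before B p q y) : B p x y ∨ B p y x := by
  rcases hB.total x p y with h | h | h
  · by_cases hxp : x = p
    · exact hxp ▸ Or.inl (hB.left x y)
    by_cases hyp : y = p
    · exact hyp ▸ Or.inr (hB.left y x)
    refine (hy ⟨?_, hyp⟩).elim
    rcases hB.of_not_before hx with h' | h'
    · exact hB.extend (Ne.symm hxp) (hB.symm _ _ _ h) h'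
    · exact hB.symm _ _ _ (hB.inner (hB.symm _ _ _ h') h)
  · exact Or.inl h
  · exact Or.inr (hB.symm _ _ _ h)

theorem total_of_before (hB : IsLinearBetweenness B) (hpq : p ≠ q) {x y : α}
    (hx : Before B p q x) (hy : Before B p q y) : B x y p ∨ B y x p := by
  rcases hB.total x p y with h | h | h
  · exfalso
    rcases hB.total x y q with h' | h' | h'
    · exact hy.2 (hB.no_star x p y q h' h hy.1).symm
    · exact hx.2 (hB.no_star y p x q h' (hB.symm _ _ _ h) hx.1).symm
    · exact hpq (hB.antisymm y p q hy.1 (hB.symm _ _ _ (hB.inner hx.1 h')))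
  · exact Or.inr (hB.symm _ _ _ h)
  · exact Or.inl h

theorem isLinearOrder_le (hB : IsLinearBetweenness B) (hpq : p ≠ q) :
    IsLinearOrder α (Le B p q) where
  refl x := by
    by_cases hx : Before B p q x
    · exact Or.inr (Or.inr ⟨hx, hx, hB.left x p⟩)
    · exact Or.inr (Or.inl ⟨hx, hx, hB.right p x⟩)
  trans x y z := by
    rintro (⟨hx, hy⟩ | ⟨hx, hy, h⟩ | ⟨hx, hy, h⟩) (⟨hy', hz⟩ | ⟨hy', hz, h'⟩ | ⟨hy', hz, h'⟩) <;>
      try contradiction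
    · exact Or.inl ⟨hx, hz⟩
    · exact Or.inr (Or.inl ⟨hx, hz, hB.trans _ _ _ _ h h'⟩)
    · exact Or.inl ⟨hx, hz⟩
    · exact Or.inr (Or.inr ⟨hx, hz,
        hB.symm _ _ _ (hB.trans _ _ _ _ (hB.symm _ _ _ h') (hB.symm _ _ _ h))⟩)
  antisymm x y := by
    rintro (⟨hx, hy⟩ | ⟨hx, hy, h⟩ | ⟨hx, hy, h⟩) (⟨hy', hz⟩ | ⟨hy', hz, h'⟩ | ⟨hy', hz, h'⟩) <;>
      try contradiction
    · exact hB.antisymm _ _ _ h h'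
    · exact hB.antisymm _ _ _ (hB.symm _ _ _ h') (hB.symm _ _ _ h)
  total x y := by
    by_cases hx : Before B p q x <;> by_cases hy : Before B p q y
    · exact (hB.total_of_before hpq hx hy).imp (fun h => Or.inr (Or.inr ⟨hx, hy, h⟩))
        (fun h => Or.inr (Or.inr ⟨hy, hx, h⟩))
    · exact Or.inl (Or.inl ⟨hx, hy⟩)
    · exact Or.inr (Or.inl ⟨hy, hx⟩)
    · exact (hB.total_of_not_before hx hy).imp (fun h => Or.inr (Or.inl ⟨hx, hy, h⟩))
        (fun h => Or.inr (Or.inl ⟨hy, hx, h⟩))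

theorem btw_of_le_of_le (hB : IsLinearBetweenness B) (hpq : p ≠ q) {x y z : α}
    (hxy : Le B p q x y) (hyz : Le B p q y z) : B x y z := by
  rcases hxy with ⟨hx, hy⟩ | ⟨hx, hy, h⟩ | ⟨hx, hy, h⟩ <;>
    rcases hyz with ⟨hy', hz⟩ | ⟨hy', hz, h'⟩ | ⟨hy', hz, h'⟩ <;> try contradiction
  · have := hB.btw_of_before_of_not_before hpq hx hz
    exact hB.symm _ _ _ (hB.trans _ _ _ _ (hB.symm _ _ _ h') (hB.symm _ _ _ this))
  · exact hB.inner h h'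
  · exact hB.trans _ _ _ _ h (hB.btw_of_before_of_not_before hpq hx hz)
  · exact hB.symm _ _ _ (hB.inner (hB.symm _ _ _ h') (hB.symm _ _ _ h))

theorem monotone_or_antitone (hB : IsLinearBetweenness B) {le : α → α → Prop}
    (hle : IsLinearOrder α le) (hcons : ∀ x y z, le x y → le y z → B x y z) {x y z : α}
    (h : B x y z) : (le x y ∧ le y z) ∨ (le z y ∧ le y x) := by
  have hr := hle.refl
  have ht := hle.total
  have anti := hB.antisymm
  have symm := hB.symm
  rcases ht x y with h₁ | h₁ <;> rcases ht y z with h₂ | h₂ <;> rcases ht x z with h₃ | h₃ <;>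
    grind

theorem le_of_consistent (hB : IsLinearBetweenness B) (hpq : p ≠ q) {le : α → α → Prop}
    (hle : IsLinearOrder α le) (hcons : ∀ x y z, le x y → le y z → B x y z) (hp : le p q)
    {x y : α} (h : Le B p q x y) : le x y := by
  have ht := hle.trans
  have ha := hle.antisymm
  have hbefore : ∀ x, Before B p q x → le x p := fun x hx => by
    rcases hB.monotone_or_antitone hle hcons hx.1 with h | h
    · exact h.1
    · exact (hpq (ha _ _ hp h.1)).elim
  have hafter : ∀ x, ¬ Before B p q x → le p x := fun x hx => by
    rcases hB.of_not_before hx with h | h <;>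
      rcases hB.monotone_or_antitone hle hcons h with h | h
    · exact h.1
    · exact (hpq (ha _ _ hp (ht _ _ _ h.1 h.2))).elim
    · exact ht _ _ _ h.1 h.2
    · exact (hpq (ha _ _ hp h.2)).elim
  rcases h with ⟨hx, hy⟩ | ⟨hx, hy, h⟩ | ⟨hx, hy, h⟩
  · exact ht _ _ _ (hbefore x hx) (hafter y hy)
  · rcases hB.monotone_or_antitone hle hcons h with h | h
    · exact h.2
    · exact ht _ _ _ h.2 (hafter y hy)
  · rcases hB.monotone_or_antitone hle hcons h with h | h
    · exact h.1
    · exact ht _ _ _ (hbefore x hx) h.1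

theorem iff_le_of_consistent (hB : IsLinearBetweenness B) (hpq : p ≠ q) {le : α → α → Prop}
    (hle : IsLinearOrder α le) (hcons : ∀ x y z, le x y → le y z → B x y z) (hp : le p q)
    (x y : α) : le x y ↔ Le B p q x y := by
  refine ⟨fun h => ?_, hB.le_of_consistent hpq hle hcons hp⟩
  have hlin := hB.isLinearOrder_le hpq
  rcases hlin.total x y with h' | h'
  · exact h'
  · rw [hle.antisymm _ _ h (hB.le_of_consistent hpq hle hcons hp h')]
    exact hlin.refl y

/-- A linear betweenness comes from a linear order, unique up to reversal. -/
theorem exists_linearOrder (hB : IsLinearBetweenness B) :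
    ∃ le : α → α → Prop, IsLinearOrder α le ∧ (∀ x y z, le x y → le y z → B x y z) ∧
      ∀ le' : α → α → Prop, IsLinearOrder α le' → (∀ x y z, le' x y → le' y z → B x y z) →
        ((∀ x y, le' x y ↔ le x y) ∨ (∀ x y, le' x y ↔ le y x)) := by
  rcases subsingleton_or_nontrivial α with hα | ⟨p, q, hpq⟩
  · refine ⟨fun _ _ => True, { refl := ?_, trans := ?_, antisymm := ?_, total := ?_ }, ?_, ?_⟩
    · exact fun _ => trivial
    · exact fun _ _ _ _ _ => trivial
    · exact fun _ _ _ _ => Subsingleton.elim _ _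
    · exact fun _ _ => Or.inl trivial
    · exact fun x y z _ _ => Subsingleton.elim x y ▸ hB.left x z
    · exact fun le' h' _ => Or.inl fun x y =>
        ⟨fun _ => trivial, fun _ => Subsingleton.elim x y ▸ h'.refl x⟩
  · refine ⟨Le B p q, hB.isLinearOrder_le hpq, fun _ _ _ => hB.btw_of_le_of_le hpq,
      fun le' h' hcons => ?_⟩
    rcases h'.total p q with hp | hp
    · exact Or.inl (hB.iff_le_of_consistent hpq h' hcons hp)
    · refine Or.inr fun x y => hB.iff_le_of_consistent (le := fun a b => le' b a) hpq ?_
        (fun a b c h₁ h₂ => hB.symm _ _ _ (hcons c b a h₂ h₁)) hp y x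
      exact { refl := h'.refl
              trans := fun a b c h₁ h₂ => h'.trans c b a h₂ h₁
              antisymm := fun a b h₁ h₂ => h'.antisymm a b h₂ h₁
              total := fun a b => h'.total b a }

end IsLinearBetweenness

namespace SetLocLattice

variable {X : Type*} {𝓜 : Set (Set X)} {sup : Set X → Set X → Set X} {Y : Set X}

theorem mem_sup_left (h : SetLocLattice 𝓜 sup) {A B : Set X} (hA : A ∈ 𝓜) (hB : B ∈ 𝓜) {x : X}
    (hx : x ∈ A) : x ∈ sup A B :=
  h.subset_sup_left A hA B hB hx

theorem mem_sup_right (h : SetLocLattice 𝓜 sup) {A B : Set X} (hA : A ∈ 𝓜) (hB : B ∈ 𝓜) {x : X}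
    (hx : x ∈ B) : x ∈ sup A B :=
  h.subset_sup_right A hA B hB hx

theorem sup_comm (h : SetLocLattice 𝓜 sup) {A B : Set X} (hA : A ∈ 𝓜) (hB : B ∈ 𝓜) :
    sup A B = sup B A :=
  Set.Subset.antisymm
    (h.sup_least A hA B hB _ (h.sup_mem B hB A hA) (h.subset_sup_right B hB A hA)
      (h.subset_sup_left B hB A hA))
    (h.sup_least B hB A hA _ (h.sup_mem A hA B hB) (h.subset_sup_right A hA B hB)
      (h.subset_sup_left A hA B hB))

theorem exists_isolating (h : SetLocLattice 𝓜 sup)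
    (hsep : ∀ x ∈ Y, ∀ y ∈ Y, x ≠ y → CompSeparated 𝓜 x y) {a b c d : X} (ha : a ∈ Y)
    (hb : b ∈ Y) (hc : c ∈ Y) (hd : d ∈ Y) (hab : a ≠ b) (hac : a ≠ c) (had : a ≠ d) :
    ∃ A ∈ 𝓜, a ∈ A ∧ b ∉ A ∧ c ∉ A ∧ d ∉ A := by
  obtain ⟨A, hA, -, -, haA, hbA, -⟩ := hsep a ha b hb hab
  obtain ⟨B, hB, -, -, haB, hcB, -⟩ := hsep a ha c hc hac
  obtain ⟨C, hC, -, -, haC, hdC, -⟩ := hsep a ha d hd had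
  exact ⟨A ∩ B ∩ C, h.inter_mem _ (h.inter_mem A hA B hB) C hC, ⟨⟨haA, haB⟩, haC⟩,
    fun h => hbA h.1.1, fun h => hcB h.1.2, fun h => hdC h.2⟩

theorem eq_inter_of_subset (h : SetLocLattice 𝓜 sup) {A B C : Set X} (hA : A ∈ 𝓜) (hB : B ∈ 𝓜)
    (hC : C ∈ 𝓜) {x y z : X} (hxA : x ∈ A) (hyA : y ∉ A) (hzA : z ∉ A) (hyB : y ∈ B)
    (hxB : x ∉ B) (hzB : z ∉ B) (hzC : z ∈ C) (hxC : x ∉ C) (hyC : y ∉ C)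
    (hsub : B ⊆ sup A C) : B = sup A B ∩ sup C B :=
  h.incomp A hA B hB C hC ⟨fun k => hxB (k hxA), fun k => hyA (k hyB)⟩
    ⟨fun k => hxC (k hxA), fun k => hzA (k hzC)⟩ ⟨fun k => hyC (k hyB), fun k => hzB (k hzC)⟩ hsub

theorem eq_inter_of_mBtw (h : SetLocLattice 𝓜 sup) {A B C : Set X} (hA : A ∈ 𝓜) (hB : B ∈ 𝓜)
    (hC : C ∈ 𝓜) {x y z : X} (hxA : x ∈ A) (hyA : y ∉ A) (hzA : z ∉ A) (hyB : y ∈ B)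
    (hxB : x ∉ B) (hzB : z ∉ B) (hzC : z ∈ C) (hxC : x ∉ C) (hyC : y ∉ C)
    (hbtw : MBtw 𝓜 x y z) : B = sup A B ∩ sup C B := by
  have hyAC : y ∈ sup A C := hbtw _ (h.sup_mem A hA C hC) (h.mem_sup_left hA hC hxA)
    (h.mem_sup_right hA hC hzC)
  rcases h.trichotomy A hA B hB C hC with k | k | k
  · have := h.eq_inter_of_subset hB hA hC hyB hxB hzB hxA hyA hzA hzC hyC hxC k
    refine (hyA ?_).elim
    rw [this]
    exact ⟨h.mem_sup_left hB hA hyB, h.sup_comm hC hA ▸ hyAC⟩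
  · exact h.eq_inter_of_subset hA hB hC hxA hyA hzA hyB hxB hzB hzC hxC hyC k
  · have := h.eq_inter_of_subset hA hC hB hxA hzA hyA hzC hxC hyC hyB hxB hzB k
    refine (hyC ?_).elim
    rw [this]
    exact ⟨hyAC, h.mem_sup_left hB hC hyB⟩

theorem mBtw_of_subset (h : SetLocLattice 𝓜 sup) {A B C : Set X} (hA : A ∈ 𝓜) (hB : B ∈ 𝓜)
    (hC : C ∈ 𝓜) {x y z : X} (hxA : x ∈ A) (hyA : y ∉ A) (hzA : z ∉ A) (hyB : y ∈ B)
    (hxB : x ∉ B) (hzB : z ∉ B) (hzC : z ∈ C) (hxC : x ∉ C) (hyC : y ∉ C)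
    (hsub : B ⊆ sup A C) : MBtw 𝓜 x y z := by
  intro M hM hxM hzM
  have heq := h.eq_inter_of_subset hA hB hC hxA hyA hzA hyB hxB hzB hzC hxC hyC hsub
  have hAM := h.inter_mem A hA M hM
  have hCM := h.inter_mem C hC M hM
  rcases h.trichotomy _ hAM B hB _ hCM with k | k | k
  · refine (hxB ?_).elim
    rw [heq]
    refine ⟨h.mem_sup_left hA hB hxA, ?_⟩
    exact h.sup_least B hB _ hCM _ (h.sup_mem C hC B hB) (h.subset_sup_right C hC B hB)
      (Set.inter_subset_left.trans (h.subset_sup_left C hC B hB)) (k ⟨hxA, hxM⟩)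
  · exact h.sup_least _ hAM _ hCM M hM Set.inter_subset_right Set.inter_subset_right (k hyB)
  · refine (hzB ?_).elim
    rw [heq]
    refine ⟨?_, h.mem_sup_left hC hB hzC⟩
    exact h.sup_least _ hAM B hB _ (h.sup_mem A hA B hB)
      (Set.inter_subset_left.trans (h.subset_sup_left A hA B hB)) (h.subset_sup_right A hA B hB)
      (k ⟨hzC, hzM⟩)

theorem mBtw_total (h : SetLocLattice 𝓜 sup)
    (hsep : ∀ x ∈ Y, ∀ y ∈ Y, x ≠ y → CompSeparated 𝓜 x y) {x y z : X} (hx : x ∈ Y)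
    (hy : y ∈ Y) (hz : z ∈ Y) : MBtw 𝓜 x y z ∨ MBtw 𝓜 y x z ∨ MBtw 𝓜 x z y := by
  by_cases hxy : x = y
  · exact Or.inl fun M _ hxM _ => hxy ▸ hxM
  by_cases hxz : x = z
  · exact Or.inr (Or.inl fun M _ _ hzM => hxz ▸ hzM)
  by_cases hyz : y = z
  · exact Or.inl fun M _ _ hzM => hyz ▸ hzM
  obtain ⟨A, hA, hxA, hyA, hzA, -⟩ := h.exists_isolating hsep hx hy hz hz hxy hxz hxz
  obtain ⟨B, hB, hyB, hxB, hzB, -⟩ :=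
    h.exists_isolating hsep hy hx hz hz (Ne.symm hxy) hyz hyz
  obtain ⟨C, hC, hzC, hxC, hyC, -⟩ :=
    h.exists_isolating hsep hz hx hy hy (Ne.symm hxz) (Ne.symm hyz) (Ne.symm hyz)
  rcases h.trichotomy A hA B hB C hC with k | k | k
  · exact Or.inr (Or.inl
      (h.mBtw_of_subset hB hA hC hyB hxB hzB hxA hyA hzA hzC hyC hxC k))
  · exact Or.inl (h.mBtw_of_subset hA hB hC hxA hyA hzA hyB hxB hzB hzC hxC hyC k)
  · exact Or.inr (Or.inr
      (h.mBtw_of_subset hA hC hB hxA hzA hyA hzC hxC hyC hyB hxB hzB k))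

theorem eq_of_mBtw_of_mBtw_of_mBtw (h : SetLocLattice 𝓜 sup)
    (hsep : ∀ x ∈ Y, ∀ y ∈ Y, x ≠ y → CompSeparated 𝓜 x y) {a b c d : X} (ha : a ∈ Y)
    (hb : b ∈ Y) (hc : c ∈ Y) (hd : d ∈ Y) (hacd : MBtw 𝓜 a c d) (habc : MBtw 𝓜 a b c)
    (hcbd : MBtw 𝓜 c b d) : b = c := by
  by_contra hbc
  have eq_of_mBtw_self : ∀ x ∈ Y, ∀ y ∈ Y, MBtw 𝓜 x y x → x = y := fun x hx y hy hxy => by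
    by_contra hne
    obtain ⟨A, hA, -, -, hxA, hyA, -⟩ := hsep x hx y hy hne
    exact hyA (hxy A hA hxA hxA)
  have hca : c ≠ a := by
    rintro rfl
    exact hbc (eq_of_mBtw_self c hc b hb habc).symm
  have hcd : c ≠ d := by
    rintro rfl
    exact hbc (eq_of_mBtw_self c hc b hb hcbd).symm
  have had : a ≠ d := by
    rintro rfl
    exact hca (eq_of_mBtw_self a ha c hc hacd).symm
  obtain ⟨A, hA, haA, hcA, hdA, -⟩ := h.exists_isolating hsep ha hc hd hd hca.symm had had
  obtain ⟨C, hC, hcC, haC, hdC, hbC⟩ :=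
    h.exists_isolating hsep hc ha hd hb hca hcd (Ne.symm hbc)
  obtain ⟨D, hD, hdD, haD, hcD, -⟩ :=
    h.exists_isolating hsep hd ha hc hc had.symm hcd.symm hcd.symm
  refine hbC ?_
  rw [h.eq_inter_of_mBtw hA hC hD haA hcA hdA hcC haC hdC hdD haD hcD hacd]
  exact ⟨habc _ (h.sup_mem A hA C hC) (h.mem_sup_left hA hC haA) (h.mem_sup_right hA hC hcC),
    hcbd _ (h.sup_mem D hD C hC) (h.mem_sup_right hD hC hcC) (h.mem_sup_left hD hC hdD)⟩

theorem mBtw_no_cycle (h : SetLocLattice 𝓜 sup)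
    (hsep : ∀ x ∈ Y, ∀ y ∈ Y, x ≠ y → CompSeparated 𝓜 x y) {a b c d : X} (ha : a ∈ Y)
    (hb : b ∈ Y) (hc : c ∈ Y) (hd : d ∈ Y) (hab : a ≠ b) (hac : a ≠ c) (had : a ≠ d)
    (hbc : b ≠ c) (hbd : b ≠ d) (hcd : c ≠ d) (habc : MBtw 𝓜 a b c) (hbcd : MBtw 𝓜 b c d)
    (hcda : MBtw 𝓜 c d a) (hdab : MBtw 𝓜 d a b) : False := by
  obtain ⟨A, hA, haA, hbA, hcA, hdA⟩ := h.exists_isolating hsep ha hb hc hd hab hac had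
  obtain ⟨B, hB, hbB, haB, hcB, hdB⟩ := h.exists_isolating hsep hb ha hc hd hab.symm hbc hbd
  obtain ⟨C, hC, hcC, haC, hbC, hdC⟩ :=
    h.exists_isolating hsep hc ha hb hd hac.symm hbc.symm hcd
  obtain ⟨D, hD, hdD, haD, hbD, hcD⟩ :=
    h.exists_isolating hsep hd ha hb hc had.symm hbd.symm hcd.symm
  have hB_eq := h.eq_inter_of_mBtw hA hB hC haA hbA hcA hbB haB hcB hcC haC hbC habc
  have hA_eq := h.eq_inter_of_mBtw hD hA hB hdD haD hbD haA hdA hbA hbB hdB haB hdab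
  have hE := h.sup_mem A hA B hB
  have haE : a ∈ sup A B := h.mem_sup_left hA hB haA
  have hbE : b ∈ sup A B := h.mem_sup_right hA hB hbB
  have hcE : c ∉ sup A B := fun k => hcB <| by
    rw [hB_eq]
    exact ⟨k, h.mem_sup_left hC hB hcC⟩
  have hdE : d ∉ sup A B := fun k => hdA <| by
    rw [hA_eq]
    exact ⟨h.mem_sup_left hD hA hdD, h.sup_comm hA hB ▸ k⟩
  have hCD := h.eq_inter_of_mBtw hB hC hD hbB hcB hdB hcC hbC hdC hdD hbD hcD hbcd
  have hDA := h.eq_inter_of_mBtw hC hD hA hcC hdC haC hdD hcD haD haA hcA hdA hcda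
  rcases h.trichotomy _ hE C hC D hD with k | k | k
  · refine hbC ?_
    rw [hCD]
    exact ⟨h.mem_sup_left hB hC hbB, h.sup_comm hC hD ▸ k hbE⟩
  · have := h.eq_inter_of_subset hE hC hD haE hcE hdE hcC haC hdC hdD haD hcD k
    refine hdC ?_
    rw [this]
    exact ⟨hcda _ (h.sup_mem _ hE C hC) (h.mem_sup_right hE hC hcC) (h.mem_sup_left hE hC haE),
      h.mem_sup_left hD hC hdD⟩
  · have := h.eq_inter_of_subset hE hD hC hbE hdE hcE hdD hbD hcD hcC hbC hdC k
    refine hcD ?_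
    rw [this]
    exact ⟨hbcd _ (h.sup_mem _ hE D hD) (h.mem_sup_left hE hD hbE) (h.mem_sup_right hE hD hdD),
      h.mem_sup_left hC hD hcC⟩

theorem isLinearBetweenness (h : SetLocLattice 𝓜 sup)
    (hsep : ∀ x ∈ Y, ∀ y ∈ Y, x ≠ y → CompSeparated 𝓜 x y) :
    IsLinearBetweenness fun x y z : Y => MBtw 𝓜 (x : X) y z where
  left _ _ := fun _ _ hx _ => hx
  symm _ _ _ hxyz := fun M hM hz hx => hxyz M hM hx hz
  total x y z := h.mBtw_total hsep x.2 y.2 z.2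
  antisymm x y z hxyz hxzy := Subtype.ext <|
    h.eq_of_mBtw_of_mBtw_of_mBtw hsep x.2 y.2 z.2 y.2 hxzy hxyz fun _ _ _ hy => hy
  trans _ _ _ _ habc hacd := fun M hM ha hd => habc M hM ha (hacd M hM ha hd)
  no_star a b c d hacd habc hcbd := Subtype.ext <|
    h.eq_of_mBtw_of_mBtw_of_mBtw hsep a.2 b.2 c.2 d.2 hacd habc hcbd
  no_cycle a b c d hab hac had hbc hbd hcd :=
    h.mBtw_no_cycle hsep a.2 b.2 c.2 d.2 (Subtype.coe_ne_coe.2 hab) (Subtype.coe_ne_coe.2 hac)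
      (Subtype.coe_ne_coe.2 had) (Subtype.coe_ne_coe.2 hbc) (Subtype.coe_ne_coe.2 hbd)
      (Subtype.coe_ne_coe.2 hcd)

end SetLocLattice

theorem consistent_order_on_completely_separated_subset {X : Type u} (𝓜 : Set (Set X))
    (sup : Set X → Set X → Set X) (h : SetLocLattice 𝓜 sup)
    (Y : Set X) (hsep : ∀ x ∈ Y, ∀ y ∈ Y, x ≠ y → CompSeparated 𝓜 x y) :
    ∃ le : Y → Y → Prop, IsLinearOrder Y le ∧
      (∀ x y z : Y, le x y → le y z → MBtw 𝓜 (x : X) y z) ∧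
      ∀ le' : Y → Y → Prop, IsLinearOrder Y le' →
        (∀ x y z : Y, le' x y → le' y z → MBtw 𝓜 (x : X) y z) →
        ((∀ x y : Y, le' x y ↔ le x y) ∨ (∀ x y : Y, le' x y ↔ le y x)) := by
  exact (h.isLinearBetweenness hsep).exists_linearOrder
end

section
/- Let L be a lattice, let I be an ideal of L and let F be a filter of L such that F ∩ I = ∅. Then there exists a semi-prime filter F̃ of L such that F ⊆ F̃ and F̃ ∩ I = ∅. -/
universe u

/-- A loc-lattice: a lattice with least element satisfying the three conditions of
Definition 1.1 of the paper. -/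
def LocLattice (L : Type u) [Lattice L] [OrderBot L] : Prop :=
  (∀ a b c : L, a ≤ b ⊔ c ∨ b ≤ a ⊔ c ∨ c ≤ a ⊔ b) ∧
  (∀ a b x : L, (¬ a ≤ b ∧ ¬ b ≤ a) → (¬ a ≤ x ∧ ¬ x ≤ a) → (¬ b ≤ x ∧ ¬ x ≤ b) →
    x ≤ a ⊔ b → (a ⊔ x) ⊓ (b ⊔ x) = x) ∧
  (∀ a b x : L, x ≤ a ⊔ b → a ⊓ x ≠ ⊥ → b ⊓ x ≠ ⊥ → (a ⊓ x) ⊔ (b ⊓ x) = x)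

/-- A filter of a lattice: a nonempty proper subset, upward closed and closed under meets. -/
def IsLatFilter {L : Type u} [Lattice L] (F : Set L) : Prop :=
  F.Nonempty ∧ F ≠ Set.univ ∧ (∀ a ∈ F, ∀ b : L, a ≤ b → b ∈ F) ∧
    ∀ a ∈ F, ∀ b ∈ F, a ⊓ b ∈ F

/-- `Ibar a b` : the internal elements of `a, b` together with `a` and `b`. -/
def Ibar {L : Type u} [Lattice L] (a b : L) : Set L :=
  {x | x ≤ a ⊔ b ∧ (a ⊓ x) ⊔ (b ⊓ x) ≠ x} ∪ {a, b}

/-- A semi-prime filter. -/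
def IsSemiPrimeFilter {L : Type u} [Lattice L] (F : Set L) : Prop :=
  IsLatFilter F ∧ ∀ a b : L, a ⊔ b ∈ F → (Ibar a b ∩ F).Nonempty

/-- A lattice is well separated if for every semi-prime filter `F` and every `x ∉ F`
there is `y ∈ F` with `¬ x ≤ y`. -/
def WellSeparatedLat (L : Type u) [Lattice L] : Prop :=
  ∀ F : Set L, IsSemiPrimeFilter F → ∀ x : L, x ∉ F → ∃ y ∈ F, ¬ x ≤ y

/-- An ideal of a lattice: a nonempty proper subset, downward closed and closed under joins. -/
def IsLatIdeal {L : Type u} [Lattice L] (I : Set L) : Prop :=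
  I.Nonempty ∧ I ≠ Set.univ ∧ (∀ a ∈ I, ∀ b : L, b ≤ a → b ∈ I) ∧
    ∀ a ∈ I, ∀ b ∈ I, a ⊔ b ∈ I

/-- A filter disjoint from a nonempty set `I` extends to a maximal such filter. -/
theorem IsLatFilter.exists_maximal_disjoint {L : Type u} [Lattice L] {I F : Set L}
    (hI : I.Nonempty) (hF : IsLatFilter F) (hdisj : F ∩ I = ∅) :
    ∃ G, F ⊆ G ∧ Maximal (fun G : Set L => IsLatFilter G ∧ G ∩ I = ∅) G := by
  refine zorn_subset_nonempty {G : Set L | IsLatFilter G ∧ G ∩ I = ∅} ?_ F ⟨hF, hdisj⟩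
  rintro c hc hchain ⟨G₀, hG₀⟩
  have hd : ⋃₀ c ∩ I = ∅ := by
    rw [Set.eq_empty_iff_forall_notMem]
    rintro x ⟨⟨G, hG, hxG⟩, hxI⟩
    exact Set.eq_empty_iff_forall_notMem.1 (hc hG).2 x ⟨hxG, hxI⟩
  refine ⟨⋃₀ c, ⟨⟨?_, ?_, ?_, ?_⟩, hd⟩, fun G hG => Set.subset_sUnion_of_mem hG⟩
  · obtain ⟨x, hx⟩ := (hc hG₀).1.1
    exact ⟨x, G₀, hG₀, hx⟩
  · intro h
    rw [h, Set.univ_inter] at hd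
    exact hI.ne_empty hd
  · rintro a ⟨G, hG, ha⟩ b hab
    exact ⟨G, hG, (hc hG).1.2.2.1 a ha b hab⟩
  · rintro a ⟨G, hG, ha⟩ b ⟨H, hH, hb⟩
    rcases hchain.total hG hH with h | h
    · exact ⟨H, hH, (hc hH).1.2.2.2 a (h ha) b hb⟩
    · exact ⟨G, hG, (hc hG).1.2.2.2 a ha b (h hb)⟩

/-- If `G` is maximal among the filters disjoint from an ideal `I`, every element outside `G`
meets some element of `G` in `I`. -/
theorem exists_inf_mem_of_maximal_disjoint {L : Type u} [Lattice L] {I G : Set L}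
    (hI : IsLatIdeal I) (hG : Maximal (fun G : Set L => IsLatFilter G ∧ G ∩ I = ∅) G)
    {a : L} (ha : a ∉ G) : ∃ g ∈ G, g ⊓ a ∈ I := by
  by_contra! h
  obtain ⟨⟨⟨g₀, hg₀⟩, -, -, hinf⟩, -⟩ := hG.prop
  have hd : {x | ∃ g ∈ G, g ⊓ a ≤ x} ∩ I = ∅ := by
    rw [Set.eq_empty_iff_forall_notMem]
    rintro x ⟨⟨g, hg, hgx⟩, hxI⟩
    exact h g hg (hI.2.2.1 x hxI _ hgx)
  have hfilter : IsLatFilter {x | ∃ g ∈ G, g ⊓ a ≤ x} := by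
    refine ⟨⟨g₀, g₀, hg₀, inf_le_left⟩, ?_, ?_, ?_⟩
    · intro hu
      rw [hu, Set.univ_inter] at hd
      exact hI.1.ne_empty hd
    · rintro x ⟨g, hg, hgx⟩ y hxy
      exact ⟨g, hg, hgx.trans hxy⟩
    · rintro x ⟨g, hg, hgx⟩ y ⟨k, hk, hky⟩
      exact ⟨g ⊓ k, hinf g hg k hk,
        le_inf ((inf_le_inf_right a inf_le_left).trans hgx)
          ((inf_le_inf_right a inf_le_right).trans hky)⟩
  exact ha (hG.le_of_ge ⟨hfilter, hd⟩ (fun x hx => ⟨x, hx, inf_le_left⟩)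
    ⟨g₀, hg₀, inf_le_right⟩)

theorem exists_semi_prime_filter_extension {L : Type u} [Lattice L]
    (I F : Set L) (hI : IsLatIdeal I) (hF : IsLatFilter F) (hdisj : F ∩ I = ∅) :
    ∃ G : Set L, IsSemiPrimeFilter G ∧ F ⊆ G ∧ G ∩ I = ∅ := by
  obtain ⟨G, hFG, hG⟩ := hF.exists_maximal_disjoint hI.1 hdisj
  refine ⟨G, ⟨hG.prop.1, fun a b hab => ?_⟩, hFG, hG.prop.2⟩
  by_cases ha : a ∈ G
  · exact ⟨a, Or.inr (Or.inl rfl), ha⟩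
  by_cases hb : b ∈ G
  · exact ⟨b, Or.inr (Or.inr rfl), hb⟩
  obtain ⟨g, hg, hga⟩ := exists_inf_mem_of_maximal_disjoint hI hG ha
  obtain ⟨k, hk, hkb⟩ := exists_inf_mem_of_maximal_disjoint hI hG hb
  obtain ⟨⟨-, -, -, hinf⟩, hd⟩ := hG.prop
  have hx : g ⊓ k ⊓ (a ⊔ b) ∈ G := hinf _ (hinf g hg k hk) _ hab
  refine ⟨g ⊓ k ⊓ (a ⊔ b), Or.inl ⟨inf_le_right, fun heq => ?_⟩, hx⟩
  refine Set.eq_empty_iff_forall_notMem.1 hd _ ⟨hx, heq ▸ hI.2.2.2 _ ?_ _ ?_⟩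
  · exact hI.2.2.1 _ hga _
      (le_inf (inf_le_right.trans (inf_le_left.trans inf_le_left)) inf_le_left)
  · exact hI.2.2.1 _ hkb _
      (le_inf (inf_le_right.trans (inf_le_left.trans inf_le_right)) inf_le_left)
end

section
/- Let L be a lattice, let X_L be the set of semi-prime filters of L, and let f : L → 𝒫(X_L) be the Stone map, f(a) = {F ∈ X_L : a ∈ F}. Then: (i) for all a, b ∈ L, a ≼ b if and only if f(a) ⊆ f(b) (so f is an order isomorphism onto its image); (ii) f(a ⊓ b) = f(a) ∩ f(b) for all a, b; (iii) f(a ⊔ b) = ⋃ {f(x) : x ∈ Ī(a,b)} for all a, b; (iv) the family f(L) separates X_L, i.e. for all distinct F, G ∈ X_L there is a ∈ L such that exactly one of F, G belongs to f(a). -/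
universe u

/-- The Stone space of a lattice: the set of all semi-prime filters. -/
abbrev StoneSpace (L : Type u) [Lattice L] : Type u := {F : Set L // IsSemiPrimeFilter F}

/-- The Stone map of a lattice. -/
def stoneMap {L : Type u} [Lattice L] (a : L) : Set (StoneSpace L) := {F | a ∈ F.1}

/-- A filter maximal among the filters avoiding `b` is semi-prime. -/
theorem IsSemiPrimeFilter.of_maximal {L : Type u} [Lattice L] {b : L} {F : Set L}
    (hF : Maximal (fun G : Set L => IsLatFilter G ∧ b ∉ G) F) : IsSemiPrimeFilter F := by
  obtain ⟨⟨hfil, hb⟩, hmax⟩ := hF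
  obtain ⟨⟨w, hw⟩, -, hup, hinf⟩ := id hfil
  have key : ∀ c : L, c ∉ F → ∃ y ∈ F, c ⊓ y ≤ b := by
    intro c hc
    by_contra! h
    have hG : IsLatFilter {x : L | ∃ y ∈ F, c ⊓ y ≤ x} := by
      refine ⟨⟨c, w, hw, inf_le_left⟩, fun hu => ?_, ?_, ?_⟩
      · have hbG : b ∈ {x : L | ∃ y ∈ F, c ⊓ y ≤ x} := hu ▸ Set.mem_univ b
        obtain ⟨y, hy, hyb⟩ := hbG
        exact h y hy hyb
      · rintro x ⟨y, hy, hyx⟩ z hxz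
        exact ⟨y, hy, hyx.trans hxz⟩
      · rintro x ⟨y, hy, hyx⟩ x' ⟨y', hy', hyx'⟩
        exact ⟨y ⊓ y', hinf y hy y' hy',
          le_inf ((inf_le_inf_left c inf_le_left).trans hyx)
            ((inf_le_inf_left c inf_le_right).trans hyx')⟩
    exact hc (hmax ⟨hG, fun ⟨y, hy, hyb⟩ => h y hy hyb⟩
      (fun x hx => ⟨x, hx, inf_le_right⟩) ⟨w, hw, inf_le_left⟩)
  refine ⟨hfil, fun c d hcd => ?_⟩
  by_cases hc : c ∈ F
  · exact ⟨c, Or.inr (Or.inl rfl), hc⟩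
  by_cases hd : d ∈ F
  · exact ⟨d, Or.inr (Or.inr rfl), hd⟩
  obtain ⟨y, hy, hyb⟩ := key c hc
  obtain ⟨z, hz, hzb⟩ := key d hd
  have hx : y ⊓ z ⊓ (c ⊔ d) ∈ F := hinf _ (hinf y hy z hz) _ hcd
  refine ⟨_, Or.inl ⟨inf_le_right, fun heq => hb (hup _ hx b ?_)⟩, hx⟩
  rw [← heq]
  exact sup_le ((inf_le_inf_left c (inf_le_left.trans inf_le_left)).trans hyb)
    ((inf_le_inf_left d (inf_le_left.trans inf_le_right)).trans hzb)

/-- Semi-prime filters separate the points of a lattice. -/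
theorem exists_isSemiPrimeFilter_of_not_le {L : Type u} [Lattice L] {a b : L} (hab : ¬ a ≤ b) :
    ∃ F : Set L, IsSemiPrimeFilter F ∧ a ∈ F ∧ b ∉ F := by
  have hIci : IsLatFilter (Set.Ici a) ∧ b ∉ Set.Ici a :=
    ⟨⟨⟨a, le_rfl⟩, fun hu => hab (hu ▸ Set.mem_univ b : b ∈ Set.Ici a),
      fun _ hx _ hxy => le_trans hx hxy, fun _ hx _ hy => le_inf hx hy⟩, hab⟩
  obtain ⟨F, haF, hF⟩ := zorn_subset_nonempty {G : Set L | IsLatFilter G ∧ b ∉ G} (by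
    intro C hC hchain hne
    have hb : b ∉ ⋃₀ C := by
      rintro ⟨G, hG, hbG⟩
      exact (hC hG).2 hbG
    refine ⟨⋃₀ C, ⟨⟨?_, fun hu => hb (hu ▸ Set.mem_univ b), ?_, ?_⟩, hb⟩,
      fun G hG => Set.subset_sUnion_of_mem hG⟩
    · obtain ⟨G, hG⟩ := hne
      obtain ⟨x, hx⟩ := (hC hG).1.1
      exact ⟨x, G, hG, hx⟩
    · rintro x ⟨G, hG, hx⟩ y hxy
      exact ⟨G, hG, (hC hG).1.2.2.1 x hx y hxy⟩
    · rintro x ⟨G, hG, hx⟩ y ⟨H, hH, hy⟩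
      rcases hchain.total hG hH with h | h
      · exact ⟨H, hH, (hC hH).1.2.2.2 x (h hx) y hy⟩
      · exact ⟨G, hG, (hC hG).1.2.2.2 x hx y (h hy)⟩) (Set.Ici a) hIci
  exact ⟨F, .of_maximal hF, haF le_rfl, hF.prop.2⟩

/-- Every element of `Ibar a b` lies below `a ⊔ b`. -/
theorem le_sup_of_mem_Ibar {L : Type u} [Lattice L] {a b x : L} (hx : x ∈ Ibar a b) :
    x ≤ a ⊔ b := by
  rcases hx with hx | rfl | rfl
  · exact hx.1
  · exact le_sup_left
  · exact le_sup_right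

theorem stone_map_properties {L : Type u} [Lattice L] :
    (∀ a b : L, a ≤ b ↔ stoneMap a ⊆ stoneMap b) ∧
    (∀ a b : L, stoneMap (a ⊓ b) = stoneMap a ∩ stoneMap b) ∧
    (∀ a b : L, stoneMap (a ⊔ b) = ⋃ x ∈ Ibar a b, stoneMap x) ∧
    (∀ F G : StoneSpace L, F ≠ G →
      ∃ a : L, (F ∈ stoneMap a ∧ G ∉ stoneMap a) ∨ (F ∉ stoneMap a ∧ G ∈ stoneMap a)) := by
  refine ⟨fun a b => ⟨fun hab F ha => F.2.1.2.2.1 a ha b hab, fun h => ?_⟩, fun a b => ?_,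
    fun a b => ?_, fun F G hFG => ?_⟩
  · by_contra hab
    obtain ⟨F, hF, ha, hb⟩ := exists_isSemiPrimeFilter_of_not_le hab
    exact hb (h (show (⟨F, hF⟩ : StoneSpace L) ∈ stoneMap a from ha))
  · ext F
    exact ⟨fun h => ⟨F.2.1.2.2.1 _ h _ inf_le_left, F.2.1.2.2.1 _ h _ inf_le_right⟩,
      fun h => F.2.1.2.2.2 _ h.1 _ h.2⟩
  · ext F
    simp only [Set.mem_iUnion, exists_prop]
    exact ⟨F.2.2 a b, fun ⟨x, hx, hxF⟩ => F.2.1.2.2.1 x hxF _ (le_sup_of_mem_Ibar hx)⟩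
  · by_contra! h
    refine hFG (Subtype.ext (Set.ext fun a => ⟨fun ha => ?_, fun ha => ?_⟩))
    · exact (h a).1 ha
    · exact by_contra fun hn => (h a).2 hn ha
end

section
/- Let L be a loc-lattice with least element 0, let X_L be the set of semi-prime filters of L and let f : L → 𝒫(X_L) be the Stone map. Then the family f(L) = {f(a) : a ∈ L}, ordered by inclusion with join f(a) ∨ f(b) = f(a ⊔ b) and meet f(a) ∧ f(b) = f(a ⊓ b), is a loc-lattice of subsets of X_L; in particular f(a ⊓ b) = f(a) ∩ f(b) for all a, b, and if f(a) ∩ f(b) ≠ ∅ then f(a ⊔ b) = f(a) ∪ f(b). Moreover, if L is well separated then the family f(L) well separates X_L. -/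
universe u

section StoneMap

variable {L : Type u} [Lattice L]

theorem stoneMap_inf (a b : L) : stoneMap (a ⊓ b) = stoneMap a ∩ stoneMap b := by
  ext ⟨F, ⟨_, _, hup, hinf⟩, _⟩
  exact ⟨fun h => ⟨hup _ h _ inf_le_left, hup _ h _ inf_le_right⟩, fun h => hinf _ h.1 _ h.2⟩

theorem stoneMap_mono {a b : L} (h : a ≤ b) : stoneMap a ⊆ stoneMap b :=
  fun F hF => F.2.1.2.2.1 a hF b h

/-- A filter which is maximal among the filters avoiding `b` is semi-prime. -/
theorem isSemiPrimeFilter_of_maximal {F : Set L} {b : L}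
    (hF : Maximal (fun F : Set L => IsLatFilter F ∧ b ∉ F) F) : IsSemiPrimeFilter F := by
  obtain ⟨⟨hlat, hb⟩, hmax⟩ := hF
  obtain ⟨hne, -, hup, hinf⟩ := id hlat
  have extend : ∀ x, x ∉ F → ∃ u ∈ F, u ⊓ x ≤ b := by
    intro x hx
    by_contra! hcon
    refine hx (hmax (y := {z | ∃ u ∈ F, u ⊓ x ≤ z}) ⟨⟨?_, ?_, ?_, ?_⟩, ?_⟩
      (fun u hu => ⟨u, hu, inf_le_left⟩) (hne.imp fun u hu => ⟨hu, inf_le_right⟩))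
    · exact ⟨x, hne.imp fun u hu => ⟨hu, inf_le_right⟩⟩
    · intro huniv
      obtain ⟨u, hu, hub⟩ := Set.eq_univ_iff_forall.mp huniv b
      exact hcon u hu hub
    · rintro a ⟨u, hu, hua⟩ c hac
      exact ⟨u, hu, hua.trans hac⟩
    · rintro a ⟨u, hu, hua⟩ c ⟨v, hv, hvc⟩
      exact ⟨u ⊓ v, hinf u hu v hv, le_inf ((inf_le_inf_right x inf_le_left).trans hua)
        ((inf_le_inf_right x inf_le_right).trans hvc)⟩
    · rintro ⟨u, hu, hub⟩
      exact hcon u hu hub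
  refine ⟨hlat, fun x y hxy => ?_⟩
  by_cases hx : x ∈ F
  · exact ⟨x, Or.inr (Or.inl rfl), hx⟩
  by_cases hy : y ∈ F
  · exact ⟨y, Or.inr (Or.inr rfl), hy⟩
  obtain ⟨u, hu, hux⟩ := extend x hx
  obtain ⟨v, hv, hvy⟩ := extend y hy
  have hw : (u ⊓ v) ⊓ (x ⊔ y) ∈ F := hinf _ (hinf u hu v hv) _ hxy
  refine ⟨_, Or.inl ⟨inf_le_right, fun heq => hb (hup _ hw b ?_)⟩, hw⟩
  rw [← heq]
  refine sup_le (le_trans ?_ hux) (le_trans ?_ hvy)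
  · exact le_inf (inf_le_right.trans (inf_le_left.trans inf_le_left)) inf_le_left
  · exact le_inf (inf_le_right.trans (inf_le_left.trans inf_le_right)) inf_le_left

theorem exists_isSemiPrimeFilter_mem_notMem {a b : L} (hab : ¬ a ≤ b) :
    ∃ F : Set L, IsSemiPrimeFilter F ∧ a ∈ F ∧ b ∉ F := by
  have hIci : IsLatFilter (Set.Ici a) ∧ b ∉ Set.Ici a := by
    refine ⟨⟨⟨a, le_rfl⟩, fun h => hab ?_, fun x hx y hxy => le_trans hx hxy,
      fun x hx y hy => le_inf hx hy⟩, hab⟩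
    exact Set.eq_univ_iff_forall.mp h b
  obtain ⟨F, hle, hF⟩ := zorn_subset_nonempty {F : Set L | IsLatFilter F ∧ b ∉ F} (by
    intro c hc hchain hcne
    have hbU : b ∉ ⋃₀ c := fun ⟨s, hs, hbs⟩ => (hc hs).2 hbs
    refine ⟨⋃₀ c, ⟨⟨?_, fun h => hbU (h ▸ Set.mem_univ b), ?_, ?_⟩, hbU⟩,
      fun s hs => Set.subset_sUnion_of_mem hs⟩
    · obtain ⟨s, hs⟩ := hcne
      exact (hc hs).1.1.mono (Set.subset_sUnion_of_mem hs)
    · rintro x ⟨s, hs, hx⟩ y hxy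
      exact ⟨s, hs, (hc hs).1.2.2.1 x hx y hxy⟩
    · rintro x ⟨s, hs, hx⟩ y ⟨t, ht, hy⟩
      obtain hst | hts := hchain.total hs ht
      · exact ⟨t, ht, (hc ht).1.2.2.2 x (hst hx) y hy⟩
      · exact ⟨s, hs, (hc hs).1.2.2.2 x hx y (hts hy)⟩) _ hIci
  exact ⟨F, isSemiPrimeFilter_of_maximal hF, hle le_rfl, hF.prop.2⟩

theorem stoneMap_subset_iff {a b : L} : stoneMap a ⊆ stoneMap b ↔ a ≤ b := by
  refine ⟨fun h => ?_, stoneMap_mono⟩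
  by_contra hab
  obtain ⟨F, hF, ha, hb⟩ := exists_isSemiPrimeFilter_mem_notMem hab
  exact hb (h (show (⟨F, hF⟩ : StoneSpace L) ∈ stoneMap a from ha))

theorem stoneMap_injective : Function.Injective (stoneMap : L → Set (StoneSpace L)) :=
  fun _ _ h => le_antisymm (stoneMap_subset_iff.mp h.subset) (stoneMap_subset_iff.mp h.superset)

theorem separatesPoints_range_stoneMap :
    SeparatesPoints (Set.range (stoneMap : L → Set (StoneSpace L))) := by
  intro F G hFG
  by_contra! hcon
  refine hFG (Subtype.ext (Set.ext fun a => ?_))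
  have := hcon (stoneMap a) ⟨a, rfl⟩
  exact ⟨this.1, fun hG => by_contra fun hF => this.2 hF hG⟩

theorem wellSeparates_range_stoneMap :
    WellSeparates (Set.range (stoneMap : L → Set (StoneSpace L))) := by
  refine ⟨separatesPoints_range_stoneMap, fun M _ F hF => ?_⟩
  obtain ⟨y, hy⟩ := F.2.1.1
  exact ⟨stoneMap y, ⟨y, rfl⟩, hy, fun hle => hF (hle hy)⟩

variable [OrderBot L]

theorem IsLatFilter.bot_notMem {F : Set L} (hF : IsLatFilter F) : ⊥ ∉ F :=
  fun h => hF.2.1 (Set.eq_univ_of_forall fun x => hF.2.2.1 ⊥ h x bot_le)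

theorem LocLattice.comparable_of_internal (h : LocLattice L) {a b x : L} (hab : a ⊓ b ≠ ⊥)
    (hx : x ≤ a ⊔ b) (hne : (a ⊓ x) ⊔ (b ⊓ x) ≠ x) : a ≤ b ∨ b ≤ a ∨ x ≤ a ∨ x ≤ b := by
  by_contra! hcon
  obtain ⟨h1, h2, h3, h4⟩ := hcon
  have hnot : ¬ a ⊓ b ≤ x := fun hle => hne <| h.2.2 a b x hx
    (fun h0 => hab (le_bot_iff.mp (h0 ▸ le_inf inf_le_left hle)))
    (fun h0 => hab (le_bot_iff.mp (h0 ▸ le_inf inf_le_right hle)))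
  have hax : ¬ a ≤ x := fun hle => hnot (inf_le_left.trans hle)
  have hbx : ¬ b ≤ x := fun hle => hnot (inf_le_right.trans hle)
  refine hnot ((inf_le_inf le_sup_left le_sup_left).trans_eq
    (h.2.1 a b x ⟨h1, h2⟩ ⟨hax, h3⟩ ⟨hbx, h4⟩ hx))

theorem LocLattice.stoneMap_sup (h : LocLattice L) {a b : L}
    (hab : (stoneMap a ∩ stoneMap b).Nonempty) :
    stoneMap (a ⊔ b) = stoneMap a ∪ stoneMap b := by
  refine Set.Subset.antisymm (fun G hG => ?_)
    (Set.union_subset (stoneMap_mono le_sup_left) (stoneMap_mono le_sup_right))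
  obtain ⟨F, ha, hb⟩ := hab
  have hbot : a ⊓ b ≠ ⊥ := fun h0 => F.2.1.bot_notMem (h0 ▸ F.2.1.2.2.2 a ha b hb)
  obtain ⟨x, ⟨hx, hne⟩ | rfl | rfl, hxG⟩ := G.2.2 a b hG
  · obtain h1 | h1 | h1 | h1 := h.comparable_of_internal hbot hx hne
    · exact Or.inr (sup_eq_right.mpr h1 ▸ hG)
    · exact Or.inl (sup_eq_left.mpr h1 ▸ hG)
    · exact Or.inl (stoneMap_mono h1 hxG)
    · exact Or.inr (stoneMap_mono h1 hxG)
  · exact Or.inl hxG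
  · exact Or.inr hxG

theorem LocLattice.setLocLattice (h : LocLattice L)
    {sup : Set (StoneSpace L) → Set (StoneSpace L) → Set (StoneSpace L)}
    (hsup : ∀ a b : L, sup (stoneMap a) (stoneMap b) = stoneMap (a ⊔ b)) :
    SetLocLattice (Set.range (stoneMap : L → Set (StoneSpace L))) sup where
  sup_mem := by
    rintro _ ⟨a, rfl⟩ _ ⟨b, rfl⟩
    exact ⟨a ⊔ b, (hsup a b).symm⟩
  subset_sup_left := by
    rintro _ ⟨a, rfl⟩ _ ⟨b, rfl⟩
    exact hsup a b ▸ stoneMap_mono le_sup_left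
  subset_sup_right := by
    rintro _ ⟨a, rfl⟩ _ ⟨b, rfl⟩
    exact hsup a b ▸ stoneMap_mono le_sup_right
  sup_least := by
    rintro _ ⟨a, rfl⟩ _ ⟨b, rfl⟩ _ ⟨c, rfl⟩
    simpa only [hsup, stoneMap_subset_iff] using sup_le
  inter_mem := by
    rintro _ ⟨a, rfl⟩ _ ⟨b, rfl⟩
    exact ⟨a ⊓ b, stoneMap_inf a b⟩
  sup_eq_union := by
    rintro _ ⟨a, rfl⟩ _ ⟨b, rfl⟩ hab
    exact (hsup a b).trans (h.stoneMap_sup hab)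
  trichotomy := by
    rintro _ ⟨a, rfl⟩ _ ⟨b, rfl⟩ _ ⟨c, rfl⟩
    simpa only [hsup, stoneMap_subset_iff] using h.1 a b c
  incomp := by
    rintro _ ⟨a, rfl⟩ _ ⟨b, rfl⟩ _ ⟨c, rfl⟩
    simp only [hsup, stoneMap_subset_iff, ← stoneMap_inf]
    intro hab hac hbc hle
    rw [h.2.1 a c b hac hab hbc.symm hle]

end StoneMap

theorem stone_image_is_set_loc_lattice {L : Type u} [Lattice L] [OrderBot L]
    (h : LocLattice L) :
    (∀ a b : L, stoneMap (a ⊓ b) = stoneMap a ∩ stoneMap b) ∧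
    (∃ sup : Set (StoneSpace L) → Set (StoneSpace L) → Set (StoneSpace L),
      (∀ a b : L, sup (stoneMap a) (stoneMap b) = stoneMap (a ⊔ b)) ∧
      SetLocLattice (Set.range (stoneMap : L → Set (StoneSpace L))) sup) ∧
    (∀ a b : L, (stoneMap a ∩ stoneMap b).Nonempty →
      stoneMap (a ⊔ b) = stoneMap a ∪ stoneMap b) ∧
    (WellSeparatedLat L →
      WellSeparates (Set.range (stoneMap : L → Set (StoneSpace L)))) := by
  refine ⟨stoneMap_inf, ?_, fun a b => h.stoneMap_sup, fun _ => wellSeparates_range_stoneMap⟩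
  have hsup : ∀ a b : L, stoneMap (Function.invFun stoneMap (stoneMap a) ⊔
      Function.invFun stoneMap (stoneMap b)) = stoneMap (a ⊔ b) := fun a b => by
    simp only [Function.leftInverse_invFun stoneMap_injective _]
  exact ⟨fun A B => stoneMap (Function.invFun stoneMap A ⊔ Function.invFun stoneMap B),
    hsup, h.setLocLattice hsup⟩
end
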